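/- Let p ∈ (0,1) with p ≠ 1/2, and ε* ∈ (0,1). Define T(ε) = (1 − ε)p + ε(1 − p) and F(ε) = −(T(ε*)·log T(ε) + (1 − T(ε*))·log(1 − T(ε))) for ε ∈ (0,1). Then F is strictly convex on (0,1), and ε* is its unique minimizer on (0,1): F(ε) > F(ε*) for every ε ∈ (0,1) with ε ≠ ε*. -/

import Mathlib

theorem aux_log_lt {a q : ℝ} (ha : 0 < a) (hq : 0 < q) (h : q ≠ a) :
    a * Real.log q - a * Real.log a < q - a := by
  have h1 : q / a ≠ 1 := by
    intro h2
    exact h ((div_eq_one_iff_eq ha.ne').1 h2)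
  have h2 := Real.log_lt_sub_one_of_pos (div_pos hq ha) h1
  rw [Real.log_div hq.ne' ha.ne'] at h2
  have h3 := mul_lt_mul_of_pos_left h2 ha
  have h4 : a * (q / a - 1) = q - a := by field_simp
  linarith

/-- identifiability of the flip parameter. With
`T(ε) = (1 − ε)p + ε(1 − p)` and `F(ε) = −(T(ε*) log T(ε) + (1 − T(ε*)) log(1 − T(ε)))`,
for `p ∈ (0,1)`, `p ≠ 1/2`, and `ε* ∈ (0,1)`, `F` is strictly convex on `(0,1)` and
`ε*` is its unique minimizer there. -/
theorem fadpo_flip_identifiability (p εstar : ℝ)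
    (hp : p ∈ Set.Ioo (0 : ℝ) 1) (hp' : p ≠ 1 / 2) (hε : εstar ∈ Set.Ioo (0 : ℝ) 1)
    (T F : ℝ → ℝ)
    (hT : T = fun ε => (1 - ε) * p + ε * (1 - p))
    (hF : F = fun ε => -(T εstar * Real.log (T ε) + (1 - T εstar) * Real.log (1 - T ε))) :
    StrictConvexOn ℝ (Set.Ioo (0 : ℝ) 1) F ∧
    ∀ ε ∈ Set.Ioo (0 : ℝ) 1, ε ≠ εstar → F εstar < F ε := by
  have hpos : ∀ ε ∈ Set.Ioo (0 : ℝ) 1, 0 < T ε ∧ 0 < 1 - T ε := by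
    rintro ε ⟨h0, h1⟩
    obtain ⟨hp0, hp1⟩ := hp
    have e1 := mul_pos (sub_pos.2 h1) hp0
    have e2 := mul_pos h0 (sub_pos.2 hp1)
    have e3 := mul_pos (sub_pos.2 h1) (sub_pos.2 hp1)
    have e4 := mul_pos h0 hp0
    rw [hT]
    constructor
    · dsimp only; linarith
    · dsimp only; linarith
  have hinj : ∀ x y, x ≠ y → T x ≠ T y := by
    intro x y hxy h
    rw [hT] at h
    dsimp only at h
    have h2 : (x - y) * (1 - 2 * p) = 0 := by linarith
    rcases mul_eq_zero.1 h2 with h3 | h3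
    · exact hxy (by linarith)
    · exact hp' (by linarith)
  have haff : ∀ x y a b : ℝ, a + b = 1 → T (a * x + b * y) = a * T x + b * T y := by
    intro x y a b hab
    obtain rfl : b = 1 - a := by linarith
    rw [hT]
    dsimp only
    ring
  obtain ⟨hs0, hs1⟩ := hpos εstar hε
  refine ⟨⟨convex_Ioo 0 1, ?_⟩, ?_⟩
  · intro x hx y hy hxy a b ha hb hab
    obtain ⟨hx0, hx1⟩ := hpos x hx
    obtain ⟨hy0, hy1⟩ := hpos y hy
    have hne := hinj x y hxy
    have l1 := strictConcaveOn_log_Ioi.2 (Set.mem_Ioi.2 hx0) (Set.mem_Ioi.2 hy0) hne ha hb hab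
    have l2 := strictConcaveOn_log_Ioi.2 (Set.mem_Ioi.2 hx1) (Set.mem_Ioi.2 hy1)
      (fun h => hne (by linarith)) ha hb hab
    simp only [smul_eq_mul] at l1 l2 ⊢
    have e : a * (1 - T x) + b * (1 - T y) = 1 - (a * T x + b * T y) := by linarith
    rw [e] at l2
    have m1 := mul_lt_mul_of_pos_left l1 hs0
    have m2 := mul_lt_mul_of_pos_left l2 hs1
    rw [hF]
    dsimp only
    rw [haff x y a b hab]
    linarith
  · intro ε hε' hne
    obtain ⟨h0, h1⟩ := hpos ε hε'
    have hn := hinj _ _ hne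
    have l1 := aux_log_lt hs0 h0 hn
    have l2 := aux_log_lt hs1 h1 (fun h => hn (by linarith))
    rw [hF]
    dsimp only
    linarith
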